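/- arXiv:1504.06380 — 4 statements merged into one kernel-verified Lean document; each statement's English description precedes it below -/
import Mathlib

section
/- Let P₁ = Σ a¹_jk(x)∂²_{jk} and P₂ = Σ a²_jk(x)∂²_{jk} be uniformly elliptic second-order operators on a connected open set Ω ⊂ ℝ³ containing 0, with smooth coefficients, and let a_β (|β| ≤ 3) be bounded 7×7-matrix-valued functions on Ω. Suppose U : Ω → ℝ⁷ is smooth, satisfies the fourth-order strongly elliptic system P₂P₁ U = Σ_{|β|≤3} a_β ∂^β U in Ω, and for every N > 0, ∫_{R ≤ |x| ≤ 2R} |U|² dx = O(R^N) as R → 0. Then for every multiindex β with |β| ≤ 4 and every N > 0, ∫_{R ≤ |x| ≤ 2R} R^{2|β|} |∂^β U|² dx = O(R^N) as R → 0. -/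
open MeasureTheory Metric Finset

noncomputable section

/-- `ℝ³` with the Euclidean norm. -/
abbrev E3 := EuclideanSpace ℝ (Fin 3)
/-- `ℝ⁷` with the Euclidean norm. -/
abbrev E7 := EuclideanSpace ℝ (Fin 7)

/-- The partial derivative `∂_i f`. -/
def pd (i : Fin 3) (f : E3 → ℝ) : E3 → ℝ :=
  fun x => fderiv ℝ f x (EuclideanSpace.single i 1)

/-- The multiindex partial derivative `∂^β f`. -/
def mpd (β : Fin 3 → ℕ) (f : E3 → ℝ) : E3 → ℝ :=
  (pd 0)^[β 0] ((pd 1)^[β 1] ((pd 2)^[β 2] f))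

/-- The length `|β|` of a multiindex. -/
def mdeg (β : Fin 3 → ℕ) : ℕ := β 0 + β 1 + β 2

/-- `f` belongs to the Gevrey class `G^s(Ω)`. -/
def GevreyOn (s : ℝ) (Ω : Set E3) (f : E3 → ℝ) : Prop :=
  ContDiffOn ℝ (⊤ : ℕ∞) f Ω ∧ ∃ c > 0, ∃ A > 0, ∀ β : Fin 3 → ℕ, ∀ x ∈ Ω,
    |mpd β f x| ≤ c * A ^ mdeg β * (Nat.factorial (mdeg β) : ℝ) ^ s

/-- The second-order operator `Σ_{j,k} a_jk(x) ∂²_{jk}` applied to a scalar function. -/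
def op2 (a : Fin 3 → Fin 3 → E3 → ℝ) (f : E3 → ℝ) : E3 → ℝ :=
  fun x => ∑ j, ∑ k, a j k x * pd j (pd k f) x

/-- Uniform (strong) ellipticity of `Σ_{j,k} a_jk(x) ∂²_{jk}` on `Ω`. -/
def UnifElliptic (a : Fin 3 → Fin 3 → E3 → ℝ) (Ω : Set E3) : Prop :=
  ∃ c0 > 0, ∀ x ∈ Ω, ∀ ξ : Fin 3 → ℝ,
    c0 * (∑ i, ξ i ^ 2) ≤ ∑ j, ∑ k, a j k x * ξ j * ξ k

/-- The coefficient matrix of the operator at a point. -/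
def coefMatrix (a : Fin 3 → Fin 3 → E3 → ℝ) (x : E3) : Matrix (Fin 3) (Fin 3) ℝ :=
  Matrix.of fun j k => a j k x

/-- `α > (λ₃ - λ₁)/λ₁` where `λ₁ ≤ λ₂ ≤ λ₃` are the eigenvalues of the coefficient
matrix at `0`: equivalently (the eigenvalues being positive), for any pair of
eigenvalues the corresponding ratio is `< α`. -/
def EigCond (a : Fin 3 → Fin 3 → E3 → ℝ) (α : ℝ) : Prop :=
  ∀ h : (coefMatrix a 0).IsHermitian, ∀ i j : Fin 3,
    (h.eigenvalues i - h.eigenvalues j) / h.eigenvalues j < α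

/-- The coefficients `a¹_jk = μ δ_jk + t_jk` of `P₁`. -/
def a1coef (t : Fin 3 → Fin 3 → E3 → ℝ) (mu : E3 → ℝ) : Fin 3 → Fin 3 → E3 → ℝ :=
  fun j k x => mu x * (if j = k then 1 else 0) + t j k x

/-- The coefficients `a²_jk = (λ + 2μ) δ_jk + t_jk` of `P₂`. -/
def a2coef (t : Fin 3 → Fin 3 → E3 → ℝ) (lam mu : E3 → ℝ) : Fin 3 → Fin 3 → E3 → ℝ :=
  fun j k x => (lam x + 2 * mu x) * (if j = k then 1 else 0) + t j k x

/-- The divergence `∇·u`. -/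
def divg (u : E3 → Fin 3 → ℝ) (x : E3) : ℝ := ∑ i, pd i (fun y => u y i) x

/-- The curl `∇×u`. -/
def curl (u : E3 → Fin 3 → ℝ) (x : E3) : Fin 3 → ℝ :=
  ![pd 1 (fun y => u y 2) x - pd 2 (fun y => u y 1) x,
    pd 2 (fun y => u y 0) x - pd 0 (fun y => u y 2) x,
    pd 0 (fun y => u y 1) x - pd 1 (fun y => u y 0) x]

/-- The infinitesimal strain `E = (∇u + (∇u)ᵗ)/2`. -/
def strain (u : E3 → Fin 3 → ℝ) (x : E3) (i j : Fin 3) : ℝ :=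
  (pd j (fun y => u y i) x + pd i (fun y => u y j) x) / 2

/-- The stress tensor `σ = T + (∇u)T + λ(tr E)I + 2μE`. -/
def stress (t : Fin 3 → Fin 3 → E3 → ℝ) (lam mu : E3 → ℝ) (u : E3 → Fin 3 → ℝ)
    (x : E3) (i j : Fin 3) : ℝ :=
  t i j x + (∑ k, pd k (fun y => u y i) x * t k j x)
    + lam x * divg u x * (if i = j then 1 else 0)
    + 2 * mu x * strain u x i j

/-- The residual stress system `∇·σ + κ²ρu = 0` on `Ω`. -/
def ResSystem (t : Fin 3 → Fin 3 → E3 → ℝ) (lam mu rho : E3 → ℝ) (κ : ℝ)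
    (u : E3 → Fin 3 → ℝ) (Ω : Set E3) : Prop :=
  ∀ x ∈ Ω, ∀ i : Fin 3,
    (∑ j, pd j (fun y => stress t lam mu u y i j) x) + κ ^ 2 * rho x * u x i = 0

/-- The vector `U = (u, ∇·u, ∇×u) : Ω → ℝ⁷`. -/
def Ufull (u : E3 → Fin 3 → ℝ) : E3 → Fin 7 → ℝ :=
  fun x => ![u x 0, u x 1, u x 2, divg u x, curl u x 0, curl u x 1, curl u x 2]

/-- The lower-order term `Σ_{|β|≤3} a_β ∂^β U`, component `i`. -/
def lowOrd (aβ : (Fin 3 → ℕ) → E3 → Fin 7 → Fin 7 → ℝ) (U : E3 → Fin 7 → ℝ)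
    (x : E3) (i : Fin 7) : ℝ :=
  ∑ β ∈ Finset.univ.filter (fun β : Fin 3 → Fin 4 => mdeg (fun k => (β k : ℕ)) ≤ 3),
    ∑ j, aβ (fun k => (β k : ℕ)) x i j * mpd (fun k => (β k : ℕ)) (fun y => U y j) x


/-- `f` vanishes to infinite order at the origin, in the pointwise sense. -/
def FlatAtZero (f : E3 → ℝ) : Prop :=
  ∀ n : ℕ, ∃ C > 0, ∃ δ > 0, ∀ x : E3, 0 < ‖x‖ → ‖x‖ < δ → |f x| ≤ C * ‖x‖ ^ n

/-- A function that is Lipschitz near the origin and whose square is dominated by a function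
with rapidly vanishing integrals over annuli is flat at the origin. -/
theorem flatAtZero_of_annulus_integral {f g : E3 → ℝ} (hf : ContDiffAt ℝ 1 f 0)
    {Ω : Set E3} (hΩ : Ω ∈ nhds (0 : E3)) (hg : ContinuousOn g Ω)
    (hfg : ∀ x, (f x) ^ 2 ≤ g x)
    (hflat : ∀ N : ℝ, 0 < N → ∃ C > 0, ∃ δ > 0, ∀ R : ℝ, 0 < R → R < δ →
      (∫ x in {y : E3 | R ≤ ‖y‖ ∧ ‖y‖ ≤ 2 * R}, g x) ≤ C * R ^ N) :
    FlatAtZero f := by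
  obtain ⟨L, t, ht, hL⟩ := hf.exists_lipschitzOnWith
  obtain ⟨ε, hε, hball⟩ := Metric.mem_nhds_iff.1 (Filter.inter_mem ht hΩ)
  intro n
  set k := n + 2 with hk
  obtain ⟨C, hC, δ, hδ, hI⟩ := hflat ((5 * k : ℕ) : ℝ) (by positivity)
  set V := volume.real (ball (0 : E3) 1) with hV
  have hVpos : 0 < V :=
    ENNReal.toReal_pos (measure_ball_pos _ _ one_pos).ne' measure_ball_lt_top.ne
  set D := max (2 * (L : ℝ)) (Real.sqrt (4 * C / V)) + 1 with hD
  have hD0 : 0 < D := by positivity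
  refine ⟨D, hD0, min (min δ (1 / 3)) (ε / 2), by positivity, fun x hx0 hx => ?_⟩
  set r := ‖x‖ with hr
  obtain ⟨⟨hrδ, hr3⟩, hrε⟩ : (r < δ ∧ r < 1 / 3) ∧ r < ε / 2 := by simpa using hx
  have hrk : r ^ k ≤ r / 3 := by
    have h1 : r ^ n ≤ 1 := pow_le_one₀ hx0.le (by linarith)
    have h2 : r ^ k = r ^ n * r ^ 2 := by rw [hk, pow_add]
    nlinarith [sq_nonneg r]
  have hrn : r ^ k ≤ r ^ n := pow_le_pow_of_le_one hx0.le (by linarith) (by omega)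
  have hrkpos : 0 < r ^ k := by positivity
  suffices h : |f x| ≤ D * r ^ k from h.trans (by gcongr)
  by_contra! hlt
  have hnorm : ∀ y ∈ ball x (r ^ k), 2 * r / 3 ≤ ‖y‖ ∧ ‖y‖ ≤ 2 * (2 * r / 3) := by
    intro y hy
    have h1 : ‖y - x‖ < r ^ k := mem_ball_iff_norm.1 hy
    have h2 := norm_sub_norm_le x y
    have h3 := norm_sub_norm_le y x
    rw [norm_sub_rev] at h2
    constructor <;> linarith
  have hsub : {y : E3 | 2 * r / 3 ≤ ‖y‖ ∧ ‖y‖ ≤ 2 * (2 * r / 3)} ⊆ ball 0 ε := by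
    intro y hy
    have := hy.2
    rw [mem_ball_zero_iff]
    linarith
  have hcomp : IsCompact {y : E3 | 2 * r / 3 ≤ ‖y‖ ∧ ‖y‖ ≤ 2 * (2 * r / 3)} := by
    refine Metric.isCompact_of_isClosed_isBounded ?_ (Metric.isBounded_ball.subset hsub)
    exact (isClosed_le continuous_const continuous_norm).inter
      (isClosed_le continuous_norm continuous_const)
  have hint : IntegrableOn g {y : E3 | 2 * r / 3 ≤ ‖y‖ ∧ ‖y‖ ≤ 2 * (2 * r / 3)} :=
    (hg.mono fun y hy => (hball (hsub hy)).2).integrableOn_compact hcomp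
  have hlow : ∀ y ∈ ball x (r ^ k), (|f x| / 2) ^ 2 ≤ g y := by
    intro y hy
    have hyt : y ∈ t := (hball (hsub (hnorm y hy))).1
    have hxt : x ∈ t := (hball (by rw [mem_ball_zero_iff]; linarith)).1
    have h1 := hL.dist_le_mul x hxt y hyt
    have h2 : dist x y ≤ r ^ k := (mem_ball'.1 hy).le
    have h3 : (L : ℝ) * dist x y ≤ L * r ^ k := by gcongr
    have h4 : 2 * (L : ℝ) * r ^ k ≤ D * r ^ k := by
      gcongr
      exact (le_max_left _ _).trans (by linarith)
    rw [Real.dist_eq] at h1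
    have h5 := abs_sub_abs_le_abs_sub (f x) (f y)
    have h6 : |f x| / 2 ≤ |f y| := by linarith
    calc (|f x| / 2) ^ 2 ≤ |f y| ^ 2 := by gcongr
      _ = (f y) ^ 2 := sq_abs _
      _ ≤ g y := hfg y
  have hvol : volume.real (ball x (r ^ k)) = (r ^ k) ^ 3 * V := by
    rw [measureReal_def, Measure.addHaar_ball _ _ hrkpos.le, ENNReal.toReal_mul,
      ENNReal.toReal_ofReal (by positivity)]
    simp [hV, measureReal_def]
  have hlower : (|f x| / 2) ^ 2 * ((r ^ k) ^ 3 * V) ≤ ∫ y in ball x (r ^ k), g y := by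
    rw [← hvol]
    exact setIntegral_ge_of_const_le_real measurableSet_ball measure_ball_lt_top.ne hlow
      (hint.mono_set hnorm)
  have hupper : ∫ y in ball x (r ^ k), g y ≤ C * (r ^ k) ^ 5 := by
    refine (setIntegral_mono_set hint
      (Filter.Eventually.of_forall fun y => (sq_nonneg _).trans (hfg y))
      (Filter.Eventually.of_forall hnorm)).trans ?_
    refine (hI (2 * r / 3) (by positivity) (by linarith)).trans ?_
    rw [Real.rpow_natCast, mul_comm 5 k, pow_mul]
    gcongr
    linarith
  have hDs : 4 * C / V < D ^ 2 := by
    have h1 : Real.sqrt (4 * C / V) < D := (le_max_right _ _).trans_lt (lt_add_one _)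
    exact (Real.sqrt_lt' hD0).1 h1
  have h1 : (D * r ^ k) ^ 2 < |f x| ^ 2 := by gcongr
  have h2 : |f x| ^ 2 * V ≤ 4 * C * (r ^ k) ^ 2 := by
    have h3 := hlower.trans hupper
    refine le_of_mul_le_mul_right ?_ (pow_pos hrkpos 3)
    nlinarith
  rw [div_lt_iff₀ hVpos] at hDs
  have h4 : 4 * C * (r ^ k) ^ 2 < D ^ 2 * V * (r ^ k) ^ 2 := by gcongr
  nlinarith

/-- Flatness at the origin passes to partial derivatives. -/
theorem FlatAtZero.pd {f : E3 → ℝ} (hflat : FlatAtZero f) (hf : ContDiffAt ℝ 2 f 0)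
    (i : Fin 3) : FlatAtZero (pd i f) := by
  have hf' : ContDiffAt ℝ 1 (fderiv ℝ f) 0 := hf.fderiv_right (by norm_num)
  obtain ⟨L, t, ht, hL⟩ := hf'.exists_lipschitzOnWith
  have hd : ∀ᶠ y in nhds (0 : E3), DifferentiableAt ℝ f y :=
    (hf.eventually (by simp)).mono fun y hy => hy.differentiableAt (by simp)
  obtain ⟨ε, hε, hball⟩ := Metric.mem_nhds_iff.1 (Filter.inter_mem ht hd)
  intro n
  set k := n + 2 with hk
  obtain ⟨C, hC, δ, hδ, hb⟩ := hflat (2 * k)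
  refine ⟨C * 2 ^ (2 * k) + C + L, by positivity, min (min (δ / 2) (1 / 2)) (ε / 2),
    by positivity, fun x hx0 hx => ?_⟩
  set r := ‖x‖ with hr
  obtain ⟨⟨hrδ, hr2⟩, hrε⟩ : (r < δ / 2 ∧ r < 1 / 2) ∧ r < ε / 2 := by simpa using hx
  have hrk : r ^ k ≤ r / 2 := by
    have h1 : r ^ n ≤ 1 := pow_le_one₀ hx0.le (by linarith)
    have h2 : r ^ k = r ^ n * r ^ 2 := by rw [hk, pow_add]
    nlinarith [sq_nonneg r]
  have hrn : r ^ k ≤ r ^ n := pow_le_pow_of_le_one hx0.le (by linarith) (by omega)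
  have hrkpos : 0 < r ^ k := by positivity
  set e : E3 := EuclideanSpace.single i 1 with he
  have hen : ‖r ^ k • e‖ = r ^ k := by
    rw [norm_smul, he, PiLp.norm_single]
    simp [abs_of_pos hx0]
  set z : E3 := x + r ^ k • e with hz
  have hsub : closedBall x (r ^ k) ⊆ ball 0 ε := by
    intro y hy
    have h1 : ‖y - x‖ ≤ r ^ k := mem_closedBall_iff_norm.1 hy
    have h3 := norm_sub_norm_le y x
    rw [mem_ball_zero_iff]
    linarith
  have hxm : x ∈ closedBall x (r ^ k) := mem_closedBall_self hrkpos.le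
  have hzm : z ∈ closedBall x (r ^ k) := by
    rw [mem_closedBall_iff_norm, hz, add_sub_cancel_left, hen]
  have hmv : ‖f z - f x - fderiv ℝ f x (z - x)‖ ≤ L * r ^ k * ‖z - x‖ := by
    refine (convex_closedBall x (r ^ k)).norm_image_sub_le_of_norm_hasFDerivWithin_le'
      (f' := fderiv ℝ f) (fun y hy => (hball (hsub hy)).2.hasFDerivAt.hasFDerivWithinAt)
      (fun y hy => ?_) hxm hzm
    rw [← dist_eq_norm]
    refine (hL.dist_le_mul y (hball (hsub hy)).1 x (hball (hsub hxm)).1).trans ?_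
    gcongr
    exact mem_closedBall.1 hy
  have hzx : z - x = r ^ k • e := by rw [hz, add_sub_cancel_left]
  rw [hzx, hen, map_smul, smul_eq_mul, Real.norm_eq_abs] at hmv
  change |fderiv ℝ f x e| ≤ _
  have hz1 : ‖z‖ ≤ 2 * r := (norm_add_le _ _).trans (by rw [hen]; linarith)
  have hz0 : 0 < ‖z‖ := by
    have := norm_sub_norm_le x (-(r ^ k • e))
    rw [sub_neg_eq_add, norm_neg, hen] at this
    linarith
  have hfx := hb x hx0 (by linarith)
  have hfz : |f z| ≤ C * (2 * r) ^ (2 * k) := (hb z hz0 (by linarith)).trans (by gcongr)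
  have hpow : r ^ (2 * k) = r ^ k * r ^ k := by rw [two_mul, pow_add]
  rw [mul_pow, hpow] at hfz
  rw [← hr, hpow] at hfx
  have key : r ^ k * |fderiv ℝ f x e| ≤ r ^ k * ((C * 2 ^ (2 * k) + C + L) * r ^ k) := by
    rw [← abs_of_pos hrkpos, ← abs_mul, abs_of_pos hrkpos]
    have h1 := abs_le.1 hmv
    have h2 := abs_le.1 hfx
    have h3 := abs_le.1 hfz
    rw [abs_le]
    constructor <;> nlinarith
  exact (le_of_mul_le_mul_left key hrkpos).trans (by gcongr)

theorem contDiffAt_pd {f : E3 → ℝ} {x : E3} (hf : ContDiffAt ℝ (⊤ : ℕ∞) f x) (i : Fin 3) :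
    ContDiffAt ℝ (⊤ : ℕ∞) (pd i f) x :=
  (hf.fderiv_right (m := (⊤ : ℕ∞)) le_rfl).clm_apply contDiffAt_const

theorem flatAtZero_iterate_pd {f : E3 → ℝ} (hf : ContDiffAt ℝ (⊤ : ℕ∞) f 0)
    (hflat : FlatAtZero f) (i : Fin 3) (n : ℕ) :
    ContDiffAt ℝ (⊤ : ℕ∞) ((pd i)^[n] f) 0 ∧ FlatAtZero ((pd i)^[n] f) := by
  induction n with
  | zero => exact ⟨hf, hflat⟩
  | succ n ih =>
    rw [Function.iterate_succ_apply']
    exact ⟨contDiffAt_pd ih.1 i, ih.2.pd (contDiffAt_infty.1 ih.1 2) i⟩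

/-- All derivatives of a smooth function that is flat at the origin are flat there. -/
theorem FlatAtZero.mpd {f : E3 → ℝ} (hflat : FlatAtZero f)
    (hf : ContDiffAt ℝ (⊤ : ℕ∞) f 0) (β : Fin 3 → ℕ) : FlatAtZero (mpd β f) := by
  have h2 := flatAtZero_iterate_pd hf hflat 2 (β 2)
  have h1 := flatAtZero_iterate_pd h2.1 h2.2 1 (β 1)
  exact (flatAtZero_iterate_pd h1.1 h1.2 0 (β 0)).2

/-- Integrals over annuli of the squares of flat functions decay rapidly. -/
theorem annulus_integral_le_of_flatAtZero {ι : Type*} [Fintype ι] {g : ι → E3 → ℝ}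
    (hg : ∀ i, FlatAtZero (g i)) (m : ℕ) (N : ℝ) :
    ∃ C > 0, ∃ δ > 0, ∀ R : ℝ, 0 < R → R < δ →
      (∫ x in {y : E3 | R ≤ ‖y‖ ∧ ‖y‖ ≤ 2 * R}, R ^ m * ∑ i, (g i x) ^ 2) ≤ C * R ^ N := by
  set n := ⌈N⌉₊ with hn
  choose C hC δ hδ hb using fun i => hg i n
  obtain ⟨δ₀, hδ₀, hδle⟩ : ∃ δ₀ > 0, ∀ i, δ₀ ≤ δ i := by
    have h : ∀ᶠ d in nhdsWithin (0 : ℝ) (Set.Ioi 0), ∀ i, d ≤ δ i :=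
      Filter.eventually_all.2 fun i =>
        nhdsWithin_le_nhds ((eventually_lt_nhds (hδ i)).mono fun _ h => h.le)
    obtain ⟨d, h1, h2⟩ := (h.and self_mem_nhdsWithin).exists
    exact ⟨d, h2, h1⟩
  set V := volume.real (closedBall (0 : E3) 2) with hV
  have hV0 : 0 ≤ V := measureReal_nonneg
  set K := ∑ i, (C i * 2 ^ n) ^ 2 with hK
  have hK0 : 0 ≤ K := Finset.sum_nonneg fun i _ => sq_nonneg _
  refine ⟨K * V + 1, by positivity, min 1 (δ₀ / 2), by positivity, fun R hR hRlt => ?_⟩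
  obtain ⟨hR1, hRδ⟩ : R < 1 ∧ R < δ₀ / 2 := by simpa using hRlt
  have hRN : R ^ n ≤ R ^ N := by
    rw [← Real.rpow_natCast]
    exact Real.rpow_le_rpow_of_exponent_ge hR hR1.le (Nat.le_ceil N)
  have hsub : {y : E3 | R ≤ ‖y‖ ∧ ‖y‖ ≤ 2 * R} ⊆ closedBall 0 2 := by
    intro y hy
    have := hy.2
    rw [mem_closedBall_zero_iff]
    linarith
  have hpt : ∀ x ∈ {y : E3 | R ≤ ‖y‖ ∧ ‖y‖ ≤ 2 * R},
      ‖R ^ m * ∑ i, (g i x) ^ 2‖ ≤ K * R ^ n := by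
    intro x hx
    have hs : ∑ i, (g i x) ^ 2 ≤ K * R ^ n := by
      rw [hK, Finset.sum_mul]
      refine Finset.sum_le_sum fun i _ => ?_
      have h1 : |g i x| ≤ C i * 2 ^ n * R ^ n := by
        refine (hb i x (hR.trans_le hx.1)
          (by linarith [hx.2, hδle i])).trans ?_
        rw [mul_assoc, ← mul_pow]
        have := hx.2
        have := hC i
        gcongr
      have h2 : (R ^ n) ^ 2 ≤ R ^ n := by
        have : R ^ n ≤ 1 := pow_le_one₀ hR.le hR1.le
        nlinarith [pow_pos hR n]
      calc (g i x) ^ 2 = |g i x| ^ 2 := (sq_abs _).symm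
        _ ≤ (C i * 2 ^ n * R ^ n) ^ 2 := by gcongr
        _ = (C i * 2 ^ n) ^ 2 * (R ^ n) ^ 2 := by ring
        _ ≤ (C i * 2 ^ n) ^ 2 * R ^ n := by gcongr
    have hs0 : 0 ≤ ∑ i, (g i x) ^ 2 := Finset.sum_nonneg fun i _ => sq_nonneg _
    rw [Real.norm_of_nonneg (by positivity)]
    exact (mul_le_of_le_one_left hs0 (pow_le_one₀ hR.le hR1.le)).trans hs
  have hfin : volume (closedBall (0 : E3) 2) < ⊤ := measure_closedBall_lt_top
  calc (∫ x in {y : E3 | R ≤ ‖y‖ ∧ ‖y‖ ≤ 2 * R}, R ^ m * ∑ i, (g i x) ^ 2)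
      ≤ ‖∫ x in {y : E3 | R ≤ ‖y‖ ∧ ‖y‖ ≤ 2 * R}, R ^ m * ∑ i, (g i x) ^ 2‖ :=
        Real.le_norm_self _
    _ ≤ K * R ^ n * volume.real {y : E3 | R ≤ ‖y‖ ∧ ‖y‖ ≤ 2 * R} :=
        norm_setIntegral_le_of_norm_le_const ((measure_mono hsub).trans_lt hfin) hpt
    _ ≤ K * R ^ n * V := by
        gcongr
        exact measureReal_mono hsub hfin.ne
    _ = K * V * R ^ n := by ring
    _ ≤ (K * V + 1) * R ^ N := by
        have := pow_pos hR n
        gcongr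
        linarith

/-- **Derivative flatness for the fourth-order system** (Lemma 3.3).  If `U`
solves the principally diagonal fourth-order strongly elliptic system
`P₂P₁U = Σ_{|β|≤3} a_β ∂^β U` with smooth uniformly elliptic `P₁, P₂` and
bounded lower-order coefficients, and `∫_{R≤|x|≤2R}|U|² = O(R^N)` for all `N`,
then `∫_{R≤|x|≤2R} R^{2|β|}|∂^β U|² = O(R^N)` for all `|β| ≤ 4` and all `N`. -/
theorem derivative_flatness_fourth_order
    (Ω : Set E3) (hΩopen : IsOpen Ω) (hΩconn : IsConnected Ω) (h0Ω : (0 : E3) ∈ Ω)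
    (a : Fin 2 → Fin 3 → Fin 3 → E3 → ℝ)
    (hsym : ∀ ℓ : Fin 2, ∀ j k : Fin 3, ∀ x ∈ Ω, a ℓ j k x = a ℓ k j x)
    (hsmooth : ∀ ℓ : Fin 2, ∀ j k : Fin 3, ContDiffOn ℝ (⊤ : ℕ∞) (a ℓ j k) Ω)
    (hell : ∀ ℓ : Fin 2, UnifElliptic (a ℓ) Ω)
    (aβ : (Fin 3 → ℕ) → E3 → Fin 7 → Fin 7 → ℝ)
    (haβ : ∃ M : ℝ, ∀ β : Fin 3 → ℕ, mdeg β ≤ 3 → ∀ x ∈ Ω, ∀ i j : Fin 7, |aβ β x i j| ≤ M)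
    (U : E3 → Fin 7 → ℝ) (hU : ∀ i : Fin 7, ContDiffOn ℝ (⊤ : ℕ∞) (fun x => U x i) Ω)
    (hsol : ∀ x ∈ Ω, ∀ i : Fin 7,
      op2 (a 1) (op2 (a 0) (fun y => U y i)) x = lowOrd aβ U x i)
    (hflat : ∀ N : ℝ, 0 < N → ∃ C > 0, ∃ δ > 0, ∀ R : ℝ, 0 < R → R < δ →
      (∫ x in {y : E3 | R ≤ ‖y‖ ∧ ‖y‖ ≤ 2 * R}, ∑ i, (U x i) ^ 2) ≤ C * R ^ N) :
    ∀ β : Fin 3 → ℕ, mdeg β ≤ 4 → ∀ N : ℝ, 0 < N → ∃ C > 0, ∃ δ > 0,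
      ∀ R : ℝ, 0 < R → R < δ →
        (∫ x in {y : E3 | R ≤ ‖y‖ ∧ ‖y‖ ≤ 2 * R},
            R ^ (2 * mdeg β) * ∑ i, (mpd β (fun y => U y i) x) ^ 2) ≤ C * R ^ N := by
  intro β _ N _
  have hΩ : Ω ∈ nhds (0 : E3) := hΩopen.mem_nhds h0Ω
  have hU0 : ∀ i, ContDiffAt ℝ (⊤ : ℕ∞) (fun x => U x i) 0 := fun i => (hU i).contDiffAt hΩ
  refine annulus_integral_le_of_flatAtZero (fun i => FlatAtZero.mpd ?_ (hU0 i) β) _ N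
  refine flatAtZero_of_annulus_integral (g := fun x => ∑ i, (U x i) ^ 2)
    ((hU0 i).of_le (by exact_mod_cast le_top)) hΩ ?_ (fun x => ?_) hflat
  · exact continuousOn_finsetSum _ fun i _ => (hU i).continuousOn.pow 2
  · exact Finset.single_le_sum (f := fun j => (U x j) ^ 2) (fun j _ => sq_nonneg _)
      (Finset.mem_univ i)
end
end

section
/- Let P₁ = Σ a¹_jk(x)∂²_{jk} and P₂ = Σ a²_jk(x)∂²_{jk} be uniformly elliptic second-order operators on a connected open set Ω ⊂ ℝ³ containing 0, with smooth coefficients, and let a_β (|β| ≤ 3) be bounded 7×7-matrix-valued functions on Ω. Suppose U : Ω → ℝ⁷ is smooth, satisfies P₂P₁ U = Σ_{|β|≤3} a_β ∂^β U in Ω, and for every N > 0, ∫_{R ≤ |x| ≤ 2R} |U|² dx = O(R^N) as R → 0. Then for every multiindex β with |β| ≤ 4 and every N > 0, ∫_{|x| ≤ R} |∂^β U|² dx = O(R^N) as R → 0. -/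
open MeasureTheory Metric Finset

noncomputable section

section Flatness

open Filter Topology Asymptotics

variable {E : Type*} [NormedAddCommGroup E] [NormedSpace ℝ E]

/-- A function, `C¹` at the origin, whose square integrals over the annuli `R ≤ ‖x‖ ≤ 2R` are
dominated by quantities vanishing to infinite order vanishes pointwise to infinite order. -/
lemma isBigO_norm_pow_of_annulus_integral_le [FiniteDimensional ℝ E] [Nontrivial E]
    [MeasurableSpace E] [BorelSpace E] (μ : Measure E) [μ.IsAddHaarMeasure]
    {f F : E → ℝ} {s : Set E} (hs : s ∈ 𝓝 0) (hF : ContinuousOn F s)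
    (hfF : ∀ x, f x ^ 2 ≤ F x) (hf : ContDiffAt ℝ 1 f 0)
    (hflat : ∀ N : ℝ, 0 < N → ∃ C > 0, ∃ δ > 0, ∀ R : ℝ, 0 < R → R < δ →
      (∫ x in {y : E | R ≤ ‖y‖ ∧ ‖y‖ ≤ 2 * R}, F x ∂μ) ≤ C * R ^ N) (m : ℕ) :
    f =O[𝓝 0] fun x => ‖x‖ ^ m := by
  have key : ∀ m : ℕ, f =O[𝓝[≠] 0] fun x => ‖x‖ ^ (m + 1) := by
    intro m
    obtain ⟨K, t, ht, hK⟩ := hf.exists_lipschitzOnWith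
    obtain ⟨ε, hε, hball⟩ := Metric.mem_nhds_iff.1 (inter_mem hs ht)
    set d := Module.finrank ℝ E
    set M := m + 1
    obtain ⟨C, hC, δ, hδ, hint⟩ := hflat ((((2 + d) * M + 1 : ℕ) : ℝ)) (by positivity)
    have hc : 0 < μ.real (ball (0 : E) 1) :=
      ENNReal.toReal_pos (measure_ball_pos μ _ one_pos).ne' measure_ball_lt_top.ne
    set c := μ.real (ball (0 : E) 1)
    set L : ℝ := max K 1
    have hL : 1 ≤ L := le_max_right _ _
    set r₀ := min (min 1 (ε / 2)) (min δ (c / 4 / 3 ^ d / C))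
    have hr₀ : 0 < r₀ := by positivity
    refine IsBigO.of_bound L ?_
    filter_upwards [self_mem_nhdsWithin, mem_nhdsWithin_of_mem_nhds (ball_mem_nhds (0 : E) hr₀)]
      with x hx0 hx
    have hr : 0 < ‖x‖ := norm_pos_iff.2 hx0
    rw [mem_ball_zero_iff] at hx
    obtain ⟨⟨h1, hε2⟩, hδ2, hlast⟩ :
        (‖x‖ < 1 ∧ ‖x‖ < ε / 2) ∧ ‖x‖ < δ ∧ ‖x‖ < c / 4 / 3 ^ d / C := by
      simpa [r₀, lt_min_iff] using hx
    set r := ‖x‖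
    rw [Real.norm_eq_abs, Real.norm_eq_abs, abs_of_pos (pow_pos hr M)]
    by_contra! hcon
    have hrM : r ^ M ≤ r := by
      simpa using pow_le_pow_of_le_one hr.le h1.le (show 1 ≤ M by simp [M])
    have hrM0 : 0 < r ^ M := pow_pos hr M
    set A := {y : E | 2 * r / 3 ≤ ‖y‖ ∧ ‖y‖ ≤ 2 * (2 * r / 3)}
    have hAcl : IsClosed A :=
      (isClosed_le continuous_const continuous_norm).inter
        (isClosed_le continuous_norm continuous_const)
    have hAε : A ⊆ ball 0 ε := fun y hy => by
      rw [mem_ball_zero_iff]; linarith [hy.2]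
    have hAcomp : IsCompact A :=
      (isCompact_closedBall (0 : E) (2 * (2 * r / 3))).of_isClosed_subset hAcl
        fun y hy => by simpa using hy.2
    have hBA : closedBall x (r ^ M / 3) ⊆ A := by
      intro y hy
      rw [mem_closedBall, dist_eq_norm] at hy
      have h2 := norm_sub_norm_le x y
      have h3 := norm_sub_norm_le y x
      rw [norm_sub_rev] at h2
      constructor <;> linarith
    have hFA : IntegrableOn F A μ :=
      (hF.mono (hAε.trans (hball.trans Set.inter_subset_left))).integrableOn_compact hAcomp
    have hxA : x ∈ A := hBA (mem_closedBall_self (by positivity))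
    have hlow : ∀ y ∈ closedBall x (r ^ M / 3), (r ^ M) ^ 2 / 4 ≤ F y := by
      intro y hy
      have h2 := hK.norm_sub_le (hball (hAε (hBA hy))).2 (hball (hAε hxA)).2
      rw [mem_closedBall, dist_eq_norm] at hy
      have h3 : (K : ℝ) * ‖y - x‖ ≤ L * (r ^ M / 3) :=
        mul_le_mul (le_max_left _ _) hy (norm_nonneg _) (by positivity)
      have h4 := abs_sub_abs_le_abs_sub (f x) (f y)
      rw [Real.norm_eq_abs, abs_sub_comm] at h2
      have h5 : r ^ M ≤ L * r ^ M := le_mul_of_one_le_left hrM0.le hL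
      have h6 : r ^ M / 2 ≤ |f y| := by linarith
      have h7 := hfF y
      rw [← sq_abs] at h7
      nlinarith
    have hge := setIntegral_ge_of_const_le_real measurableSet_closedBall
      measure_closedBall_lt_top.ne hlow (hFA.mono_set hBA)
    have hmono := setIntegral_mono_set hFA
      (Eventually.of_forall fun y => (sq_nonneg (f y)).trans (hfF y)) hBA.eventuallyLE
    have hup := hint (2 * r / 3) (by positivity) (by linarith)
    rw [Real.rpow_natCast] at hup
    have hpow : (2 * r / 3) ^ ((2 + d) * M + 1) ≤ r ^ ((2 + d) * M + 1) :=
      pow_le_pow_left₀ (by positivity) (by linarith) _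
    rw [Measure.addHaar_real_closedBall μ x (by positivity)] at hge
    have htot := hge.trans (hmono.trans (hup.trans (mul_le_mul_of_nonneg_left hpow hC.le)))
    have e1 : (r ^ M) ^ 2 / 4 * ((r ^ M / 3) ^ d * c) =
        r ^ ((2 + d) * M) * (c / 4 / 3 ^ d) := by
      rw [div_pow]; ring
    have e2 : C * r ^ ((2 + d) * M + 1) = r ^ ((2 + d) * M) * (r * C) := by ring
    rw [lt_div_iff₀ hC] at hlast
    have := mul_lt_mul_of_pos_left hlast (pow_pos hr ((2 + d) * M))
    linarith
  have hf0 : f 0 = 0 := by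
    have h0 : Tendsto (fun x : E => ‖x‖ ^ (0 + 1)) (𝓝[≠] 0) (𝓝 0) := by
      simpa using (continuous_norm.tendsto (0 : E)).mono_left nhdsWithin_le_nhds
    exact tendsto_nhds_unique (hf.continuousAt.tendsto.mono_left nhdsWithin_le_nhds)
      ((key 0).trans_tendsto h0)
  have hsucc : f =O[𝓝 0] fun x => ‖x‖ ^ (m + 1) := by
    rw [← pure_sup_nhdsNE, isBigO_sup]
    exact ⟨by rw [isBigO_pure]; simp [hf0], key m⟩
  refine hsucc.trans (IsBigO.of_bound 1 ?_)
  filter_upwards [ball_mem_nhds (0 : E) one_pos] with x hx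
  simpa using pow_le_pow_of_le_one (norm_nonneg x) (mem_ball_zero_iff.1 hx).le m.le_succ

/-- Vanishing to infinite order is inherited by directional derivatives. -/
lemma isBigO_norm_pow_fderiv_apply {f : E → ℝ} (hf : ContDiffAt ℝ 2 f 0)
    (hflat : ∀ m : ℕ, f =O[𝓝 0] fun x => ‖x‖ ^ m) {v : E} (hv : ‖v‖ = 1) (m : ℕ) :
    (fun x => fderiv ℝ f x v) =O[𝓝 0] fun x => ‖x‖ ^ m := by
  obtain ⟨K, t, ht, hK⟩ := (hf.fderiv_right (m := 1) (by norm_num)).exists_lipschitzOnWith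
  obtain ⟨C, hC, hbound⟩ := (hflat (2 * (m + 1))).exists_pos
  have hdiff : ∀ᶠ x in 𝓝 (0 : E), DifferentiableAt ℝ f x :=
    (hf.eventually (by simp)).mono fun x hx => hx.differentiableAt (by norm_num)
  obtain ⟨ε, hε, hball⟩ := Metric.mem_nhds_iff.1 (inter_mem ht (inter_mem hdiff hbound.bound))
  refine IsBigO.of_bound (C * 2 ^ (2 * (m + 1)) + C + K) ?_
  have hmain : ∀ x : E, x ≠ 0 → ‖x‖ < min 1 (ε / 2) →
      ‖fderiv ℝ f x v‖ ≤ (C * 2 ^ (2 * (m + 1)) + C + K) * ‖x‖ ^ (m + 1) := by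
    intro x hx0 hx
    obtain ⟨h1, hε2⟩ := lt_min_iff.1 hx
    have hr : 0 < ‖x‖ := norm_pos_iff.2 hx0
    set r := ‖x‖
    set h := r ^ (m + 1) with hh
    have hpos : 0 < h := pow_pos hr _
    have hle : h ≤ r := by
      simpa using pow_le_pow_of_le_one hr.le h1.le (show 1 ≤ m + 1 by simp)
    have hcb : closedBall x h ⊆ ball 0 ε := fun y hy => by
      rw [mem_closedBall, dist_eq_norm] at hy
      rw [mem_ball_zero_iff]
      linarith [norm_sub_norm_le y x]
    have hxm : x ∈ closedBall x h := mem_closedBall_self hpos.le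
    have hym : x + h • v ∈ closedBall x h := by
      simp [dist_eq_norm, norm_smul, hv, abs_of_pos hpos]
    have hT := Convex.norm_image_sub_le_of_norm_fderiv_le' (𝕜 := ℝ) (f := f)
      (φ := fderiv ℝ f x) (C := K * h)
      (fun z hz => (hball (hcb hz)).2.1)
      (fun z hz => by
        have h2 := hK.norm_sub_le (hball (hcb hz)).1 (hball (hcb hxm)).1
        rw [mem_closedBall, dist_eq_norm] at hz
        exact h2.trans (mul_le_mul_of_nonneg_left hz K.2))
      (convex_closedBall x h) hxm hym
    have hb1 : ‖f x‖ ≤ C * ‖‖x‖ ^ (2 * (m + 1))‖ := (hball (hcb hxm)).2.2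
    have hb2 : ‖f (x + h • v)‖ ≤ C * ‖‖x + h • v‖ ^ (2 * (m + 1))‖ := (hball (hcb hym)).2.2
    have hn : ‖x + h • v‖ ≤ 2 * r := by
      refine (norm_add_le _ _).trans ?_
      rw [norm_smul, hv, Real.norm_eq_abs, abs_of_pos hpos]
      linarith
    have hb3 : ‖x + h • v‖ ^ (2 * (m + 1)) ≤ (2 * r) ^ (2 * (m + 1)) :=
      pow_le_pow_left₀ (norm_nonneg _) hn _
    have e1 : r ^ (2 * (m + 1)) = h * h := by rw [hh]; ring
    rw [norm_pow, norm_norm] at hb1 hb2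
    rw [mul_pow, e1] at hb3
    have hb4 := hb2.trans (mul_le_mul_of_nonneg_left hb3 hC.le)
    change ‖f x‖ ≤ C * r ^ (2 * (m + 1)) at hb1
    rw [e1] at hb1
    simp only [add_sub_cancel_left, map_smul, smul_eq_mul, norm_smul, hv, mul_one,
      Real.norm_eq_abs, abs_of_pos hpos] at hT hb1 hb4 ⊢
    have hA : |h * fderiv ℝ f x v| ≤ |f (x + h • v)| + |f x| + K * h * h := by
      have h2 := abs_le.1 hT
      have h3 := abs_le.1 (abs_sub (f (x + h • v)) (f x))
      exact abs_le.2 ⟨by linarith, by linarith⟩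
    rw [abs_mul, abs_of_pos hpos] at hA
    refine le_of_mul_le_mul_left ?_ hpos
    calc h * |fderiv ℝ f x v| ≤ _ := hA
      _ ≤ C * (2 ^ (2 * (m + 1)) * (h * h)) + C * (h * h) + K * h * h := by gcongr
      _ = _ := by ring
  have h0 : fderiv ℝ f 0 = 0 :=
    (IsBigO.hasFDerivAt (n := 2) (by simpa using hflat 2) (by norm_num)).fderiv
  filter_upwards [ball_mem_nhds (0 : E) (show 0 < min 1 (ε / 2) by positivity)] with x hx
  rw [mem_ball_zero_iff] at hx
  rw [norm_pow, norm_norm]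
  rcases eq_or_ne x 0 with rfl | hx0
  · rw [h0]
    simp only [zero_apply, norm_zero]
    positivity
  · refine (hmain x hx0 hx).trans (mul_le_mul_of_nonneg_left ?_ (by positivity))
    exact pow_le_pow_of_le_one (norm_nonneg x) (hx.le.trans (min_le_left _ _)) m.le_succ

end Flatness

lemma contDiffOn_pd {Ω : Set E3} (hΩ : IsOpen Ω) {f : E3 → ℝ}
    (hf : ContDiffOn ℝ (⊤ : ℕ∞) f Ω) (i : Fin 3) : ContDiffOn ℝ (⊤ : ℕ∞) (pd i f) Ω :=
  (hf.fderiv_of_isOpen hΩ le_rfl).clm_apply contDiffOn_const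

open Filter Topology Asymptotics in
/-- Smoothness near the origin together with vanishing to infinite order there is inherited by
all multiindex derivatives. -/
lemma isBigO_norm_pow_mpd {Ω : Set E3} (hΩ : IsOpen Ω) (h0 : (0 : E3) ∈ Ω) {f : E3 → ℝ}
    (hf : ContDiffOn ℝ (⊤ : ℕ∞) f Ω) (hflat : ∀ m : ℕ, f =O[𝓝 0] fun x => ‖x‖ ^ m)
    (β : Fin 3 → ℕ) (m : ℕ) : mpd β f =O[𝓝 0] fun x => ‖x‖ ^ m := by
  let Flat : (E3 → ℝ) → Prop := fun g =>
    ContDiffOn ℝ (⊤ : ℕ∞) g Ω ∧ ∀ m : ℕ, g =O[𝓝 0] fun x => ‖x‖ ^ m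
  have hpd : ∀ (i : Fin 3) (g : E3 → ℝ), Flat g → Flat (pd i g) := fun i g hg =>
    ⟨contDiffOn_pd hΩ hg.1 i, isBigO_norm_pow_fderiv_apply
      ((hg.1.contDiffAt (hΩ.mem_nhds h0)).of_le
        (WithTop.coe_le_coe.2 (le_top : (2 : ℕ∞) ≤ ⊤))) hg.2 (by simp)⟩
  have hiter : ∀ (i : Fin 3) (n : ℕ) (g : E3 → ℝ), Flat g → Flat ((pd i)^[n] g) := by
    intro i n
    induction n with
    | zero => exact fun g hg => hg
    | succ n ih => exact fun g hg => ih _ (hpd i g hg)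
  exact (hiter 0 _ _ (hiter 1 _ _ (hiter 2 _ _ ⟨hf, hflat⟩))).2 m

open Filter Topology Asymptotics in
/-- A function vanishing to infinite order at the origin has integrals over small balls vanishing
to infinite order. -/
lemma setIntegral_le_of_isBigO_norm_pow {g : E3 → ℝ}
    (hg : ∀ m : ℕ, g =O[𝓝 0] fun x => ‖x‖ ^ m) (N : ℝ) :
    ∃ C > 0, ∃ δ > 0, ∀ R : ℝ, 0 < R → R < δ →
      (∫ x in {y : E3 | ‖y‖ ≤ R}, g x) ≤ C * R ^ N := by
  obtain ⟨C, hC, hb⟩ := (hg ⌈N⌉₊).exists_pos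
  obtain ⟨ε, hε, hball⟩ := Metric.mem_nhds_iff.1 hb.bound
  have hV : 0 < volume.real (closedBall (0 : E3) 1) :=
    ENNReal.toReal_pos (measure_closedBall_pos _ _ one_pos).ne' measure_closedBall_lt_top.ne
  refine ⟨C * volume.real (closedBall (0 : E3) 1), by positivity, min 1 ε, by positivity,
    fun R hR hRδ => ?_⟩
  obtain ⟨hR1, hRε⟩ := lt_min_iff.1 hRδ
  have hset : {y : E3 | ‖y‖ ≤ R} = closedBall 0 R := by ext; simp
  have hbd : ∀ x ∈ closedBall (0 : E3) R, ‖g x‖ ≤ C * R ^ ⌈N⌉₊ := by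
    intro x hx
    rw [mem_closedBall_zero_iff] at hx
    have h1 : ‖g x‖ ≤ C * ‖‖x‖ ^ ⌈N⌉₊‖ := hball (mem_ball_zero_iff.2 (hx.trans_lt hRε))
    rw [norm_pow, norm_norm] at h1
    exact h1.trans (by gcongr)
  have hpow : R ^ ⌈N⌉₊ ≤ R ^ N := by
    rw [← Real.rpow_natCast]
    exact Real.rpow_le_rpow_of_exponent_ge hR hR1.le (Nat.le_ceil N)
  have hvol : volume.real (closedBall (0 : E3) R) ≤ volume.real (closedBall (0 : E3) 1) :=
    measureReal_mono (closedBall_subset_closedBall hR1.le) measure_closedBall_lt_top.ne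
  rw [hset]
  calc (∫ x in closedBall 0 R, g x) ≤ ‖∫ x in closedBall 0 R, g x‖ := Real.le_norm_self _
    _ ≤ C * R ^ ⌈N⌉₊ * volume.real (closedBall (0 : E3) R) :=
      norm_setIntegral_le_of_norm_le_const measure_closedBall_lt_top hbd
    _ ≤ C * R ^ N * volume.real (closedBall (0 : E3) 1) := by gcongr
    _ = _ := by ring

/-- **Flatness of all derivatives on balls** (Remark 3.4).  If `U` solves the
principally diagonal fourth-order strongly elliptic system
`P₂P₁U = Σ_{|β|≤3} a_β ∂^β U` with smooth uniformly elliptic `P₁, P₂` and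
bounded lower-order coefficients, and `∫_{R≤|x|≤2R}|U|² = O(R^N)` for all `N`,
then `∫_{|x|≤R}|∂^β U|² = O(R^N)` for all `|β| ≤ 4` and all `N`. -/
theorem ball_flatness_fourth_order
    (Ω : Set E3) (hΩopen : IsOpen Ω) (hΩconn : IsConnected Ω) (h0Ω : (0 : E3) ∈ Ω)
    (a : Fin 2 → Fin 3 → Fin 3 → E3 → ℝ)
    (hsym : ∀ ℓ : Fin 2, ∀ j k : Fin 3, ∀ x ∈ Ω, a ℓ j k x = a ℓ k j x)
    (hsmooth : ∀ ℓ : Fin 2, ∀ j k : Fin 3, ContDiffOn ℝ (⊤ : ℕ∞) (a ℓ j k) Ω)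
    (hell : ∀ ℓ : Fin 2, UnifElliptic (a ℓ) Ω)
    (aβ : (Fin 3 → ℕ) → E3 → Fin 7 → Fin 7 → ℝ)
    (haβ : ∃ M : ℝ, ∀ β : Fin 3 → ℕ, mdeg β ≤ 3 → ∀ x ∈ Ω, ∀ i j : Fin 7, |aβ β x i j| ≤ M)
    (U : E3 → Fin 7 → ℝ) (hU : ∀ i : Fin 7, ContDiffOn ℝ (⊤ : ℕ∞) (fun x => U x i) Ω)
    (hsol : ∀ x ∈ Ω, ∀ i : Fin 7,
      op2 (a 1) (op2 (a 0) (fun y => U y i)) x = lowOrd aβ U x i)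
    (hflat : ∀ N : ℝ, 0 < N → ∃ C > 0, ∃ δ > 0, ∀ R : ℝ, 0 < R → R < δ →
      (∫ x in {y : E3 | R ≤ ‖y‖ ∧ ‖y‖ ≤ 2 * R}, ∑ i, (U x i) ^ 2) ≤ C * R ^ N) :
    ∀ β : Fin 3 → ℕ, mdeg β ≤ 4 → ∀ N : ℝ, 0 < N → ∃ C > 0, ∃ δ > 0,
      ∀ R : ℝ, 0 < R → R < δ →
        (∫ x in {y : E3 | ‖y‖ ≤ R},
            ∑ i, (mpd β (fun y => U y i) x) ^ 2) ≤ C * R ^ N := by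
  have hmem : Ω ∈ nhds (0 : E3) := hΩopen.mem_nhds h0Ω
  have hcont : ContinuousOn (fun x => ∑ i, (U x i) ^ 2) Ω :=
    continuousOn_finsetSum _ fun i _ => (hU i).continuousOn.pow 2
  have hUflat : ∀ (i : Fin 7) (m : ℕ),
      (fun x => U x i) =O[nhds 0] fun x : E3 => ‖x‖ ^ m := fun i =>
    isBigO_norm_pow_of_annulus_integral_le volume hmem hcont
      (fun x => Finset.single_le_sum (f := fun i => (U x i) ^ 2)
        (fun j _ => sq_nonneg (U x j)) (Finset.mem_univ i))
      (((hU i).contDiffAt hmem).of_le (by exact_mod_cast le_top)) hflat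
  intro β _ N _
  refine setIntegral_le_of_isBigO_norm_pow (fun m => ?_) N
  refine Asymptotics.IsBigO.fun_sum fun i _ => ?_
  have h1 := isBigO_norm_pow_mpd hΩopen h0Ω (hU i) (hUflat i) β m
  have h2 := isBigO_norm_pow_mpd hΩopen h0Ω (hU i) (hUflat i) β 0
  simpa [sq] using h1.mul h2
end
end

section
/- Let U ⊂ ℝ³ be a bounded open set with 0 ∈ U, let s ≥ 1, and let f ∈ G^s(U) satisfy ∂^β f(0) = 0 for all multiindices β. If ρ > s − 1, then there is δ > 0 such that |f(x)| ≤ e^{−|x|^{−1/ρ}} for all x with 0 < |x| < δ. -/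
open MeasureTheory Metric Finset

noncomputable section

/-- Every partial derivative of a smooth function on an open set is smooth there. -/
lemma contDiffOn_pd_s11 {U : Set E3} (hU : IsOpen U) {g : E3 → ℝ}
    (hg : ContDiffOn ℝ (⊤ : ℕ∞) g U) (i : Fin 3) : ContDiffOn ℝ (⊤ : ℕ∞) (pd i g) U :=
  (hg.fderiv_of_isOpen hU (by simp)).clm_apply contDiffOn_const

lemma contDiffOn_pd_iterate {U : Set E3} (hU : IsOpen U) {g : E3 → ℝ}
    (hg : ContDiffOn ℝ (⊤ : ℕ∞) g U) (i : Fin 3) (n : ℕ) :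
    ContDiffOn ℝ (⊤ : ℕ∞) ((pd i)^[n] g) U := by
  induction n with
  | zero => simpa using hg
  | succ n ih =>
    rw [Function.iterate_succ_apply']
    exact contDiffOn_pd_s11 hU ih i

lemma contDiffOn_mpd {U : Set E3} (hU : IsOpen U) {g : E3 → ℝ}
    (hg : ContDiffOn ℝ (⊤ : ℕ∞) g U) (β : Fin 3 → ℕ) :
    ContDiffOn ℝ (⊤ : ℕ∞) (mpd β g) U :=
  contDiffOn_pd_iterate hU
    (contDiffOn_pd_iterate hU (contDiffOn_pd_iterate hU hg 2 _) 1 _) 0 _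

lemma eqOn_pd {U : Set E3} (hU : IsOpen U) {g h : E3 → ℝ} (hgh : Set.EqOn g h U)
    (i : Fin 3) : Set.EqOn (pd i g) (pd i h) U := fun x hx => by
  simp only [pd, (hgh.eventuallyEq_of_mem (hU.mem_nhds hx)).fderiv_eq]

lemma eqOn_pd_iterate {U : Set E3} (hU : IsOpen U) {g h : E3 → ℝ} (hgh : Set.EqOn g h U)
    (i : Fin 3) (n : ℕ) : Set.EqOn ((pd i)^[n] g) ((pd i)^[n] h) U := by
  induction n with
  | zero => simpa using hgh
  | succ n ih =>
    simp only [Function.iterate_succ_apply']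
    exact eqOn_pd hU ih i

/-- Partial derivatives of a smooth function commute. -/
lemma pd_comm {U : Set E3} (hU : IsOpen U) {g : E3 → ℝ}
    (hg : ContDiffOn ℝ (⊤ : ℕ∞) g U) (i j : Fin 3) :
    Set.EqOn (pd i (pd j g)) (pd j (pd i g)) U := fun x hx => by
  have hd : DifferentiableAt ℝ (fderiv ℝ g) x :=
    ((hg.fderiv_of_isOpen (m := (⊤ : ℕ∞)) hU (by simp)).contDiffAt
      (hU.mem_nhds hx)).differentiableAt (by simp)
  have hsymm : IsSymmSndFDerivAt ℝ g x :=
    (hg.contDiffAt (hU.mem_nhds hx)).isSymmSndFDerivAt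
      (by simpa using (WithTop.coe_le_coe.mpr le_top : ((2 : ℕ∞) : WithTop ℕ∞) ≤ (⊤ : ℕ∞)))
  have key (k l : Fin 3) : pd k (pd l g) x =
      fderiv ℝ (fderiv ℝ g) x (EuclideanSpace.single k 1) (EuclideanSpace.single l 1) := by
    change fderiv ℝ (fun y => fderiv ℝ g y (EuclideanSpace.single l 1)) x _ = _
    rw [fderiv_clm_apply hd (differentiableAt_const _)]
    simp
  rw [key, key, hsymm.eq]

lemma pd_iterate_comm {U : Set E3} (hU : IsOpen U) {g : E3 → ℝ}
    (hg : ContDiffOn ℝ (⊤ : ℕ∞) g U) (i j : Fin 3) (n : ℕ) :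
    Set.EqOn (pd i ((pd j)^[n] g)) ((pd j)^[n] (pd i g)) U := by
  induction n with
  | zero => exact fun x _ => rfl
  | succ n ih =>
    simp only [Function.iterate_succ_apply']
    exact (pd_comm hU (contDiffOn_pd_iterate hU hg j n) i j).trans (eqOn_pd hU ih j)

/-- A partial derivative of `∂^β g` is a multiindex derivative of order `|β| + 1`. -/
lemma exists_pd_mpd_eqOn {U : Set E3} (hU : IsOpen U) {g : E3 → ℝ}
    (hg : ContDiffOn ℝ (⊤ : ℕ∞) g U) (i : Fin 3) (β : Fin 3 → ℕ) :
    ∃ γ : Fin 3 → ℕ, mdeg γ = mdeg β + 1 ∧ Set.EqOn (pd i (mpd β g)) (mpd γ g) U := by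
  have h2 := contDiffOn_pd_iterate hU hg 2 (β 2)
  have h1 := contDiffOn_pd_iterate hU h2 1 (β 1)
  fin_cases i
  · refine ⟨![β 0 + 1, β 1, β 2], by simp [mdeg]; ring, fun x _ => ?_⟩
    simp [mpd, Function.iterate_succ_apply']
  · refine ⟨![β 0, β 1 + 1, β 2], by simp [mdeg]; ring, ?_⟩
    simpa [mpd, Function.iterate_succ_apply'] using pd_iterate_comm hU h1 1 0 (β 0)
  · refine ⟨![β 0, β 1, β 2 + 1], by simp [mdeg]; ring, ?_⟩
    simpa [mpd, Function.iterate_succ_apply'] using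
      (pd_iterate_comm hU h1 2 0 (β 0)).trans
        (eqOn_pd_iterate hU (pd_iterate_comm hU h2 2 1 (β 1)) 0 (β 0))

lemma abs_fderiv_apply_le {g : E3 → ℝ} {y : E3} {C : ℝ} (hC : ∀ i, |pd i g y| ≤ C)
    (x : E3) : |fderiv ℝ g y x| ≤ 3 * C * ‖x‖ := by
  have hx : fderiv ℝ g y x = ∑ i, x i * pd i g y := by
    conv_lhs => rw [← (EuclideanSpace.basisFun (Fin 3) ℝ).sum_repr x]
    simp [pd]
  calc |fderiv ℝ g y x| ≤ ∑ i, |x i * pd i g y| := by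
        rw [hx]; exact Finset.abs_sum_le_sum_abs _ _
    _ ≤ ∑ _i : Fin 3, ‖x‖ * C := Finset.sum_le_sum fun i _ => by
        rw [abs_mul]
        exact mul_le_mul (PiLp.norm_apply_le x i) (hC i) (abs_nonneg _) (norm_nonneg _)
    _ = 3 * C * ‖x‖ := by simp; ring

/-- Integrating a power bound on the partial derivatives along rays from the origin. -/
lemma abs_le_of_abs_pd_le {g : E3 → ℝ} {R M : ℝ} {N : ℕ}
    (hg : DifferentiableOn ℝ g (ball 0 R)) (hg0 : g 0 = 0)
    (hpd : ∀ i, ∀ y ∈ ball (0 : E3) R, |pd i g y| ≤ M * ‖y‖ ^ N) {x : E3}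
    (hx : x ∈ ball (0 : E3) R) : |g x| ≤ 3 * M * ‖x‖ ^ (N + 1) / (N + 1) := by
  have hmem : ∀ t ∈ Set.Icc (0 : ℝ) 1, t • x ∈ ball (0 : E3) R := fun t ht => by
    rw [mem_ball_zero_iff] at hx ⊢
    rw [norm_smul, Real.norm_of_nonneg ht.1]
    exact (mul_le_of_le_one_left (norm_nonneg _) ht.2).trans_lt hx
  have hderiv : ∀ t ∈ Set.Icc (0 : ℝ) 1,
      HasDerivAt (fun t : ℝ => g (t • x)) (fderiv ℝ g (t • x) x) t := fun t ht => by
    have h1 := (hg.differentiableAt (isOpen_ball.mem_nhds (hmem t ht))).hasFDerivAt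
    have h2 : HasDerivAt (fun t : ℝ => t • x) x t := by
      simpa using (hasDerivAt_id t).smul_const x
    exact h1.comp_hasDerivAt t h2
  have hB (t : ℝ) : HasDerivAt (fun t : ℝ => 3 * M * ‖x‖ ^ (N + 1) / (N + 1) * t ^ (N + 1))
      (3 * M * ‖x‖ ^ (N + 1) * t ^ N) t := by
    refine ((hasDerivAt_pow (N + 1) t).const_mul
      (3 * M * ‖x‖ ^ (N + 1) / ((N : ℝ) + 1))).congr_deriv ?_
    have : (N : ℝ) + 1 ≠ 0 := by positivity
    push_cast
    field_simp
  have := image_norm_le_of_norm_deriv_right_le_deriv_boundary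
    (fun t ht => (hderiv t ht).continuousAt.continuousWithinAt)
    (fun t ht => (hderiv t (Set.Ico_subset_Icc_self ht)).hasDerivWithinAt)
    (by simp [hg0]) hB
    (fun t ht => by
      have hb := abs_fderiv_apply_le
        (fun i => hpd i _ (hmem t (Set.Ico_subset_Icc_self ht))) x
      rw [norm_smul, Real.norm_of_nonneg ht.1] at hb
      rw [Real.norm_eq_abs]
      exact hb.trans_eq (by ring))
    (Set.right_mem_Icc.mpr zero_le_one)
  simpa using this

/-- Taylor bound at a point where all derivatives vanish. -/
lemma abs_mpd_le_of_flat {U : Set E3} (hU : IsOpen U) {f : E3 → ℝ}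
    (hf : ContDiffOn ℝ (⊤ : ℕ∞) f U) (hflat : ∀ β, mpd β f 0 = 0) {R : ℝ}
    (hR : ball 0 R ⊆ U) {K : ℕ} {M : ℝ}
    (hM : ∀ β, mdeg β = K → ∀ x ∈ U, |mpd β f x| ≤ M) (N : ℕ) :
    ∀ β, mdeg β + N = K → ∀ x ∈ ball (0 : E3) R,
      |mpd β f x| ≤ M * 3 ^ N / N.factorial * ‖x‖ ^ N := by
  induction N with
  | zero => intro β hβ x hx; simpa using hM β hβ x (hR hx)
  | succ N ih =>
    intro β hβ x hx
    refine (abs_le_of_abs_pd_le (N := N) (M := M * 3 ^ N / N.factorial)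
      (((contDiffOn_mpd hU hf β).mono hR).differentiableOn (by simp)) (hflat β)
      (fun i y hy => ?_) hx).trans_eq ?_
    · obtain ⟨γ, hγ, heq⟩ := exists_pd_mpd_eqOn hU hf i β
      rw [heq (hR hy)]
      exact ih γ (by omega) y hy
    · rw [Nat.factorial_succ]
      push_cast
      field_simp
      ring

open Filter Topology in
/-- Optimizing `c (B r)^N (N!)^σ` over `N` gives the bound `exp (-r^{-1/ρ})` for small `r`. -/
lemma exists_exp_decay_of_factorial_bound {c B σ ρ : ℝ} (hc : 0 < c) (hB : 0 < B)
    (hσ : 0 ≤ σ) (hρ : σ < ρ) : ∃ δ > (0 : ℝ), ∀ r : ℝ, 0 < r → r < δ →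
      ∃ N : ℕ, c * (B * r) ^ N * (N.factorial : ℝ) ^ σ ≤ Real.exp (-(r ^ (-(1 / ρ)))) := by
  have hρ0 : 0 < ρ := hσ.trans_lt hρ
  have hlarge : Tendsto (fun r : ℝ => r ^ (-(1 / ρ))) (𝓝[>] 0) atTop :=
    tendsto_rpow_neg_nhdsGT_zero (by simpa using hρ0)
  have hsmall : Tendsto (fun r : ℝ => B * 2 ^ σ * r ^ (1 - σ / ρ)) (𝓝[>] 0) (𝓝 0) := by
    have hpos : 0 < 1 - σ / ρ := by rw [sub_pos, div_lt_one hρ0]; exact hρ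
    have h := (Real.continuousAt_rpow_const 0 (1 - σ / ρ) (Or.inr hpos.le)).tendsto.mono_left
      (nhdsWithin_le_nhds (s := Set.Ioi 0))
    rw [Real.zero_rpow hpos.ne'] at h
    simpa using h.const_mul (B * 2 ^ σ)
  have hev : ∀ᶠ r : ℝ in 𝓝[>] 0, max 1 (Real.log c) ≤ r ^ (-(1 / ρ)) ∧
      B * 2 ^ σ * r ^ (1 - σ / ρ) < Real.exp (-2) :=
    (hlarge.eventually_ge_atTop _).and (hsmall.eventually_lt_const (Real.exp_pos _))
  obtain ⟨δ, hδ, hsub⟩ := mem_nhdsGT_iff_exists_Ioo_subset.mp hev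
  refine ⟨δ, hδ, fun r hr hrδ => ?_⟩
  obtain ⟨hL, hq⟩ := hsub ⟨hr, hrδ⟩
  set L := r ^ (-(1 / ρ)) with hLdef
  have hL1 : 1 ≤ L := (le_max_left _ _).trans hL
  set N := ⌈L⌉₊
  have hLN : L ≤ N := Nat.le_ceil L
  have hN2 : (N : ℝ) ≤ 2 * L := by linarith [Nat.ceil_lt_add_one (zero_le_one.trans hL1)]
  have hcN : c ≤ Real.exp N := by
    rw [← Real.log_le_iff_le_exp hc]
    exact (le_max_right _ _).trans (hL.trans hLN)
  have hbase : B * r * (N : ℝ) ^ σ ≤ Real.exp (-2) := by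
    calc B * r * (N : ℝ) ^ σ ≤ B * r * (2 * L) ^ σ := by gcongr
      _ = B * 2 ^ σ * r ^ (1 - σ / ρ) := by
        rw [Real.mul_rpow zero_le_two (zero_le_one.trans hL1), hLdef, ← Real.rpow_mul hr.le,
          sub_eq_add_neg, Real.rpow_add hr, Real.rpow_one,
          show -(1 / ρ) * σ = -(σ / ρ) by ring]
        ring
      _ ≤ Real.exp (-2) := hq.le
  refine ⟨N, ?_⟩
  calc c * (B * r) ^ N * (N.factorial : ℝ) ^ σ
      ≤ c * (B * r) ^ N * ((N : ℝ) ^ N) ^ σ := by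
        gcongr
        exact_mod_cast N.factorial_le_pow
    _ = c * (B * r * (N : ℝ) ^ σ) ^ N := by
        rw [← Real.rpow_natCast (N : ℝ) N, ← Real.rpow_mul N.cast_nonneg, mul_comm (N : ℝ) σ,
          Real.rpow_mul N.cast_nonneg, Real.rpow_natCast, mul_pow (B * r), mul_assoc]
    _ ≤ Real.exp N * Real.exp (-2) ^ N := by gcongr
    _ = Real.exp (-N) := by
        rw [← Real.exp_nat_mul, ← Real.exp_add]
        congr 1
        ring
    _ ≤ Real.exp (-L) := Real.exp_le_exp.mpr (neg_le_neg hLN)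

/-- **Decay of flat Gevrey functions** (Lemma 5.1).  If `f ∈ G^s(U)` on a
bounded open neighborhood `U` of `0`, all derivatives of `f` vanish at `0`, and
`ρ > s - 1`, then `|f(x)| ≤ e^{-|x|^{-1/ρ}}` near `0`. -/
theorem gevrey_flat_decay
    (U : Set E3) (hUopen : IsOpen U) (hUbdd : Bornology.IsBounded U) (h0U : (0 : E3) ∈ U)
    (s ρ : ℝ) (hs : 1 ≤ s)
    (f : E3 → ℝ) (hf : GevreyOn s U f)
    (hflat : ∀ β : Fin 3 → ℕ, mpd β f 0 = 0)
    (hρ : s - 1 < ρ) :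
    ∃ δ > (0 : ℝ), ∀ x : E3, 0 < ‖x‖ → ‖x‖ < δ →
      |f x| ≤ Real.exp (-(‖x‖ ^ (-(1 / ρ)))) := by
  obtain ⟨hsmooth, c, hc, A, hA, hbound⟩ := hf
  obtain ⟨R, hR, hball⟩ := Metric.isOpen_iff.mp hUopen 0 h0U
  obtain ⟨δ, hδ, hdecay⟩ := exists_exp_decay_of_factorial_bound (B := 3 * A) hc
    (by positivity) (sub_nonneg.mpr hs) hρ
  refine ⟨min δ R, lt_min hδ hR, fun x hx0 hx => ?_⟩
  obtain ⟨N, hN⟩ := hdecay ‖x‖ hx0 (hx.trans_le (min_le_left _ _))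
  have hxR : x ∈ ball (0 : E3) R := by
    rw [mem_ball_zero_iff]
    exact hx.trans_le (min_le_right _ _)
  have htaylor := abs_mpd_le_of_flat hUopen hsmooth hflat hball (K := N)
    (M := c * A ^ N * (N.factorial : ℝ) ^ s)
    (fun β hβ y hy => hβ ▸ hbound β y hy) N 0 (by simp [mdeg]) x hxR
  refine (htaylor.trans_eq ?_).trans hN
  have hfac : (0 : ℝ) < N.factorial := by exact_mod_cast N.factorial_pos
  rw [Real.rpow_sub_one hfac.ne', mul_pow, mul_pow]
  ring
end
end

section
/- Let ρ > 0 and s = 1 + ρ. Then the function f : ℝ³ → ℝ defined by f(x) = e^{−|x|^{−1/ρ}} for x ≠ 0 and f(0) = 0 belongs to the Gevrey class G^s(ℝ³); in particular f is C^∞ on ℝ³ and there exist constants c, A > 0 such that |∂^β f(x)| ≤ c·A^{|β|}·(|β|!)^s for every multiindex β and every x ∈ ℝ³. -/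
open MeasureTheory Metric Finset

noncomputable section

/-- The inclusion `ℝ³ → ℂ³`. -/
def complexify : E3 →L[ℝ] (Fin 3 → ℂ) :=
  ContinuousLinearMap.pi fun i => Complex.ofRealCLM ∘L (EuclideanSpace.proj i : E3 →L[ℝ] ℝ)

@[simp]
lemma complexify_apply (x : E3) (i : Fin 3) : complexify x i = (x i : ℂ) := rfl

lemma complexify_single (i : Fin 3) :
    complexify (EuclideanSpace.single i 1) = Pi.single i 1 := by
  ext j
  by_cases h : j = i
  · subst h; simp
  · simp [h]

/-- The set of `z ∈ ℂ³` with `Re (z₁² + z₂² + z₃²) > 0`. -/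
def sqSumPos : Set (Fin 3 → ℂ) := {z | 0 < (∑ i, z i ^ 2).re}

lemma isOpen_sqSumPos : IsOpen sqSumPos :=
  isOpen_lt continuous_const (Complex.continuous_re.comp (by fun_prop))

/-- The holomorphic extension of `exp (-‖x‖ ^ (-(1 / ρ)))` to `sqSumPos`. -/
def expNegCpow (ρ : ℝ) (z : Fin 3 → ℂ) : ℂ :=
  Complex.exp (-((∑ i, z i ^ 2) ^ ((-(1 / ρ) / 2 : ℝ) : ℂ)))

lemma analyticOnNhd_expNegCpow (ρ : ℝ) : AnalyticOnNhd ℂ (expNegCpow ρ) sqSumPos := by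
  intro z hz
  have h1 : AnalyticAt ℂ (fun z : Fin 3 → ℂ => ∑ i, z i ^ 2) z :=
    Finset.analyticAt_fun_sum _ fun i _ =>
      ((ContinuousLinearMap.proj (R := ℂ) (φ := fun _ : Fin 3 => ℂ) i).analyticAt z).pow 2
  exact ((h1.cpow analyticAt_const (Or.inl hz)).neg).cexp

lemma sum_sq_complexify (x : E3) : ∑ i, complexify x i ^ 2 = ((‖x‖ ^ 2 : ℝ) : ℂ) := by
  rw [EuclideanSpace.real_norm_sq_eq]
  simp

lemma complexify_mem_sqSumPos {x : E3} (hx : x ≠ 0) : complexify x ∈ sqSumPos := by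
  change 0 < (∑ i, complexify x i ^ 2).re
  rw [sum_sq_complexify, Complex.ofReal_re]
  positivity

lemma expNegCpow_complexify (ρ : ℝ) (x : E3) :
    expNegCpow ρ (complexify x) = (Real.exp (-(‖x‖ ^ (-(1 / ρ)))) : ℂ) := by
  rw [expNegCpow, sum_sq_complexify, ← Complex.ofReal_cpow (by positivity),
    ← Real.rpow_natCast, ← Real.rpow_mul (norm_nonneg x)]
  push_cast
  congr 5
  ring_nf

lemma norm_sum_sq_sub_le {x : E3} {ε : ℝ} (hε1 : ε ≤ 1) {z : Fin 3 → ℂ}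
    (hz : z ∈ closedBall (complexify x) (ε * ‖x‖)) :
    ‖∑ i, z i ^ 2 - ((‖x‖ ^ 2 : ℝ) : ℂ)‖ ≤ 9 * ε * ‖x‖ ^ 2 := by
  rw [← sum_sq_complexify, ← Finset.sum_sub_distrib]
  have key : ∀ i : Fin 3, ‖z i ^ 2 - complexify x i ^ 2‖ ≤ 3 * ε * ‖x‖ ^ 2 := by
    intro i
    have h1 : ‖z i - complexify x i‖ ≤ ε * ‖x‖ :=
      (norm_le_pi_norm (z - complexify x) i).trans (mem_closedBall_iff_norm.1 hz)
    have h2 : ‖complexify x i‖ ≤ ‖x‖ := by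
      simpa using PiLp.norm_apply_le x i
    have h3 : ‖z i + complexify x i‖ ≤ 3 * ‖x‖ := by
      calc ‖z i + complexify x i‖ = ‖(z i - complexify x i) + 2 * complexify x i‖ := by
            congr 1; ring
        _ ≤ ‖z i - complexify x i‖ + 2 * ‖complexify x i‖ := by
            refine (norm_add_le _ _).trans_eq ?_
            rw [norm_mul, Complex.norm_ofNat]
        _ ≤ 3 * ‖x‖ := by nlinarith [norm_nonneg x]
    calc ‖z i ^ 2 - complexify x i ^ 2‖ = ‖z i + complexify x i‖ * ‖z i - complexify x i‖ := by
          rw [← norm_mul]; congr 1; ring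
      _ ≤ (3 * ‖x‖) * (ε * ‖x‖) := by gcongr
      _ = 3 * ε * ‖x‖ ^ 2 := by ring
  calc _ ≤ ∑ i : Fin 3, ‖z i ^ 2 - complexify x i ^ 2‖ := norm_sum_le _ _
    _ ≤ ∑ _i : Fin 3, 3 * ε * ‖x‖ ^ 2 := Finset.sum_le_sum fun i _ => key i
    _ = 9 * ε * ‖x‖ ^ 2 := by simp; ring

/-- On polydiscs of radius proportional to `‖x‖`, the holomorphic extension decays like
`exp (-‖x‖ ^ (-(1 / ρ)) / 2)`. -/
lemma exists_norm_expNegCpow_le (ρ : ℝ) : ∃ ε > (0 : ℝ), ∀ x : E3, x ≠ 0 →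
    ∀ z ∈ closedBall (complexify x) (ε * ‖x‖),
      z ∈ sqSumPos ∧ ‖expNegCpow ρ z‖ ≤ Real.exp (-(‖x‖ ^ (-(1 / ρ)) / 2)) := by
  have hc : ContinuousAt (fun u : ℂ => (u ^ ((-(1 / ρ) / 2 : ℝ) : ℂ)).re) 1 :=
    Complex.continuous_re.continuousAt.comp
      (continuousAt_cpow_const (Or.inl (by simp)))
  have hev : ∀ᶠ u : ℂ in nhds 1, 1 / 2 < (u ^ ((-(1 / ρ) / 2 : ℝ) : ℂ)).re :=
    hc.eventually (lt_mem_nhds (by simp; norm_num))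
  obtain ⟨d, hd, hball⟩ := Metric.eventually_nhds_iff_ball.1 hev
  refine ⟨min d 1 / 18, by positivity, fun x hx z hz => ?_⟩
  have hr : 0 < ‖x‖ := norm_pos_iff.2 hx
  have hm : 0 < min d 1 := by positivity
  have hm1 : min d 1 ≤ 1 := min_le_right _ _
  set u : ℂ := (∑ i, z i ^ 2) / ((‖x‖ ^ 2 : ℝ) : ℂ) with hu
  have hr2 : ((‖x‖ ^ 2 : ℝ) : ℂ) ≠ 0 := by exact_mod_cast (pow_pos hr 2).ne'
  have hzu : ∑ i, z i ^ 2 = ((‖x‖ ^ 2 : ℝ) : ℂ) * u := by rw [hu]; field_simp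
  have hu1 : ‖u - 1‖ < min d 1 := by
    have h := norm_sum_sq_sub_le (by linarith) hz
    have h2 : u - 1 = (∑ i, z i ^ 2 - ((‖x‖ ^ 2 : ℝ) : ℂ)) / ((‖x‖ ^ 2 : ℝ) : ℂ) := by
      rw [hu]; field_simp
    rw [h2, norm_div, Complex.norm_real, Real.norm_of_nonneg (by positivity),
      div_lt_iff₀ (by positivity)]
    refine h.trans_lt ?_
    have : 0 < min d 1 * ‖x‖ ^ 2 := by positivity
    linarith
  have hure : 0 < u.re := by
    have h : |(u - 1).re| < 1 := (Complex.abs_re_le_norm (u - 1)).trans_lt (hu1.trans_le hm1)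
    rw [Complex.sub_re, Complex.one_re, abs_lt] at h
    linarith
  have hu0 : u ≠ 0 := fun h => by simp [h] at hure
  have hpow : (∑ i, z i ^ 2) ^ ((-(1 / ρ) / 2 : ℝ) : ℂ)
      = ((‖x‖ ^ (-(1 / ρ)) : ℝ) : ℂ) * u ^ ((-(1 / ρ) / 2 : ℝ) : ℂ) := by
    rw [hzu, Complex.cpow_def_of_ne_zero (mul_ne_zero hr2 hu0),
      Complex.log_ofReal_mul (by positivity) hu0, add_mul, Complex.exp_add,
      ← Complex.cpow_def_of_ne_zero hu0, ← Complex.ofReal_mul, ← Complex.ofReal_exp,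
      ← Real.rpow_def_of_pos (by positivity), ← Real.rpow_natCast,
      ← Real.rpow_mul (norm_nonneg x)]
    congr 3
    push_cast
    ring
  refine ⟨?_, ?_⟩
  · change 0 < (∑ i, z i ^ 2).re
    rw [hzu, Complex.re_ofReal_mul]
    positivity
  · rw [expNegCpow, Complex.norm_exp, hpow, Complex.neg_re, Complex.re_ofReal_mul]
    have h := hball u (mem_ball_iff_norm.2 (hu1.trans_le (min_le_left _ _)))
    have hp : 0 < ‖x‖ ^ (-(1 / ρ)) := by positivity
    gcongr
    nlinarith

/-- A single step of Cauchy's estimate for a partial derivative on `ℂ³`. -/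
lemma norm_fderiv_single_le {G : (Fin 3 → ℂ) → ℂ} {U : Set (Fin 3 → ℂ)}
    (hG : AnalyticOnNhd ℂ G U) {z : Fin 3 → ℂ} {δ M : ℝ} (hδ : 0 < δ)
    (hU : closedBall z δ ⊆ U) (hM : ∀ w ∈ closedBall z δ, ‖G w‖ ≤ M) (i : Fin 3) :
    ‖fderiv ℂ G z (Pi.single i 1)‖ ≤ M / δ := by
  set e : Fin 3 → ℂ := Pi.single i 1 with he
  have hmem : ∀ t ∈ closedBall (0 : ℂ) δ, z + t • e ∈ closedBall z δ := by
    intro t ht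
    rw [mem_closedBall_iff_norm] at ht ⊢
    rw [add_sub_cancel_left, norm_smul, he, Pi.norm_single, norm_one, mul_one]
    simpa using ht
  have hd : ∀ t ∈ closedBall (0 : ℂ) δ,
      HasDerivAt (fun t : ℂ => G (z + t • e)) (fderiv ℂ G (z + t • e) e) t := by
    intro t ht
    have h1 : HasDerivAt (fun t : ℂ => z + t • e) e t := by
      simpa using ((hasDerivAt_id t).smul_const e).const_add z
    exact (hG _ (hU (hmem t ht))).differentiableAt.hasFDerivAt.comp_hasDerivAt t h1
  have h0 := (hd 0 (mem_closedBall_self hδ.le)).deriv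
  rw [zero_smul, add_zero] at h0
  rw [← h0]
  refine Complex.norm_deriv_le_of_forall_mem_sphere_norm_le hδ ?_ fun t ht =>
    hM _ (hmem t (sphere_subset_closedBall ht))
  exact DifferentiableOn.diffContOnCl_ball
    (fun t ht => (hd t ht).differentiableAt.differentiableWithinAt) subset_rfl

/-- The elementary inequality `e^{-t/2} r^{-k} ≤ (2ρ)^{ρk} (k!)^ρ` with `t = r ^ (-1/ρ)`. -/
lemma exp_neg_rpow_mul_inv_pow_le {ρ : ℝ} (hρ : 0 < ρ) {r : ℝ} (hr : 0 < r) (k : ℕ) :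
    Real.exp (-(r ^ (-(1 / ρ)) / 2)) * (r⁻¹) ^ k
      ≤ ((2 * ρ) ^ ρ) ^ k * (Nat.factorial k : ℝ) ^ ρ := by
  set t : ℝ := r ^ (-(1 / ρ)) with ht
  have htpos : 0 < t := by positivity
  have hrt : r⁻¹ = t ^ ρ := by
    rw [ht, ← Real.rpow_mul hr.le, ← Real.rpow_neg_one]
    congr 1
    field_simp
  have hk : (0 : ℝ) < Nat.factorial k := by positivity
  have h1 : Real.exp (-(t / (2 * ρ))) * t ^ k ≤ (2 * ρ) ^ k * Nat.factorial k := by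
    have h := Real.pow_div_factorial_le_exp (t / (2 * ρ)) (by positivity) k
    rw [div_le_iff₀ hk, div_pow, div_le_iff₀ (by positivity)] at h
    calc _ ≤ Real.exp (-(t / (2 * ρ))) *
          (Real.exp (t / (2 * ρ)) * Nat.factorial k * (2 * ρ) ^ k) := by gcongr
      _ = (Real.exp (-(t / (2 * ρ))) * Real.exp (t / (2 * ρ))) *
          ((2 * ρ) ^ k * Nat.factorial k) := by ring
      _ = _ := by rw [← Real.exp_add, neg_add_cancel, Real.exp_zero, one_mul]
  have h2 := Real.rpow_le_rpow (by positivity) h1 hρ.le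
  rw [Real.mul_rpow (by positivity) (by positivity), Real.mul_rpow (by positivity) (by positivity),
    ← Real.exp_mul, ← Real.rpow_pow_comm htpos.le, ← Real.rpow_pow_comm (by positivity)] at h2
  rw [hrt]
  convert h2 using 3
  field_simp

lemma hasFDerivAt_of_eq_complexify {g : E3 → ℝ} {G : (Fin 3 → ℂ) → ℂ}
    (hG : AnalyticOnNhd ℂ G sqSumPos) (hg : ∀ x : E3, x ≠ 0 → (g x : ℂ) = G (complexify x))
    {x : E3} (hx : x ≠ 0) :
    HasFDerivAt g (Complex.reCLM ∘L
      ((fderiv ℂ G (complexify x)).restrictScalars ℝ ∘L complexify)) x := by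
  have h1 := ((hG _ (complexify_mem_sqSumPos hx)).differentiableAt.hasFDerivAt.restrictScalars
    ℝ).comp x complexify.hasFDerivAt
  refine (Complex.reCLM.hasFDerivAt.comp x h1).congr_of_eventuallyEq ?_
  filter_upwards [isOpen_ne.mem_nhds hx] with y hy
  simp [← hg y hy]

/-- The derivative of a real function extending holomorphically extends holomorphically. -/
lemma ofReal_pd_eq_fderiv {g : E3 → ℝ} {G : (Fin 3 → ℂ) → ℂ}
    (hG : AnalyticOnNhd ℂ G sqSumPos) (hg : ∀ x : E3, x ≠ 0 → (g x : ℂ) = G (complexify x))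
    (i : Fin 3) {x : E3} (hx : x ≠ 0) :
    (pd i g x : ℂ) = fderiv ℂ G (complexify x) (Pi.single i 1) := by
  have h1 := ((hG _ (complexify_mem_sqSumPos hx)).differentiableAt.hasFDerivAt.restrictScalars
    ℝ).comp x complexify.hasFDerivAt
  have h2 := Complex.ofRealCLM.hasFDerivAt.comp x
    (hasFDerivAt_of_eq_complexify hG hg hx).differentiableAt.hasFDerivAt
  have h3 := h2.congr_of_eventuallyEq (f₁ := G ∘ complexify) (by
    filter_upwards [isOpen_ne.mem_nhds hx] with y hy
    simp [← hg y hy])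
  have h4 := congrArg (fun L : E3 →L[ℝ] ℂ => L (EuclideanSpace.single i 1)) (h3.unique h1)
  simpa [pd, complexify_single] using h4

/-- `g` vanishes at the origin and extends holomorphically to `sqSumPos`, with the bounds
satisfied by the partial derivatives of order `n` of `exp (-‖x‖ ^ (-(1 / ρ)))`. -/
def HasConicExtension (ρ ε : ℝ) (n : ℕ) (g : E3 → ℝ) : Prop :=
  g 0 = 0 ∧ ∃ G : (Fin 3 → ℂ) → ℂ, AnalyticOnNhd ℂ G sqSumPos ∧
    (∀ x : E3, x ≠ 0 → (g x : ℂ) = G (complexify x)) ∧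
    ∀ x : E3, x ≠ 0 → ∀ δ > (0 : ℝ), ∀ m : ℕ, (m + n) * δ ≤ ε * ‖x‖ →
      ∀ z ∈ closedBall (complexify x) (m * δ),
        ‖G z‖ ≤ Real.exp (-(‖x‖ ^ (-(1 / ρ)) / 2)) / δ ^ n

namespace HasConicExtension

variable {ρ ε : ℝ} {n : ℕ} {g : E3 → ℝ}

lemma abs_le (hε : 0 < ε) (h : HasConicExtension ρ ε n g) {x : E3} (hx : x ≠ 0) :
    |g x| ≤ Real.exp (-(‖x‖ ^ (-(1 / ρ)) / 2)) * (‖x‖⁻¹) ^ n * ((n + 1) / ε) ^ n := by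
  obtain ⟨-, G, -, hgG, hb⟩ := h
  have hr : 0 < ‖x‖ := norm_pos_iff.2 hx
  have h := hb x hx (ε * ‖x‖ / (n + 1)) (by positivity) 0
    (by
      rw [← mul_div_assoc, div_le_iff₀ (by positivity)]
      have : 0 < ε * ‖x‖ := by positivity
      push_cast
      nlinarith)
    (complexify x) (by simp)
  rw [← hgG x hx, Complex.norm_real, Real.norm_eq_abs] at h
  refine h.trans_eq ?_
  rw [div_eq_mul_inv, ← inv_pow, inv_div, mul_assoc, ← mul_pow]
  congr 2
  field_simp

lemma isBigO (hρ : 0 < ρ) (hε : 0 < ε) (h : HasConicExtension ρ ε n g) :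
    g =O[nhds 0] fun x => ‖x - 0‖ ^ 2 := by
  refine Asymptotics.IsBigO.of_bound (((2 * ρ) ^ ρ) ^ (n + 2) *
    (Nat.factorial (n + 2) : ℝ) ^ ρ * ((n + 1) / ε) ^ n) (Filter.Eventually.of_forall fun x => ?_)
  rw [Real.norm_eq_abs, sub_zero, norm_pow, norm_norm]
  rcases eq_or_ne x 0 with rfl | hx
  · simp [h.1]
  have hr : 0 < ‖x‖ := norm_pos_iff.2 hx
  calc |g x| ≤ Real.exp (-(‖x‖ ^ (-(1 / ρ)) / 2)) * (‖x‖⁻¹) ^ n * ((n + 1) / ε) ^ n :=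
        h.abs_le hε hx
    _ = (Real.exp (-(‖x‖ ^ (-(1 / ρ)) / 2)) * (‖x‖⁻¹) ^ (n + 2)) * ((n + 1) / ε) ^ n
          * ‖x‖ ^ 2 := by
        rw [pow_add]
        generalize ((n + 1) / ε) ^ n = K
        field_simp
    _ ≤ _ := by
        refine mul_le_mul_of_nonneg_right (mul_le_mul_of_nonneg_right ?_ ?_) ?_
        · exact exp_neg_rpow_mul_inv_pow_le hρ hr (n + 2)
        all_goals positivity

lemma hasFDerivAt_zero (hρ : 0 < ρ) (hε : 0 < ε) (h : HasConicExtension ρ ε n g) :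
    HasFDerivAt g (0 : E3 →L[ℝ] ℝ) 0 :=
  (h.isBigO hρ hε).hasFDerivAt one_lt_two

lemma differentiable (hρ : 0 < ρ) (hε : 0 < ε) (h : HasConicExtension ρ ε n g) :
    Differentiable ℝ g := by
  intro x
  rcases eq_or_ne x 0 with rfl | hx
  · exact (h.hasFDerivAt_zero hρ hε).differentiableAt
  · obtain ⟨-, G, hG, hgG, -⟩ := h
    exact (hasFDerivAt_of_eq_complexify hG hgG hx).differentiableAt

lemma pd (hρ : 0 < ρ) (hε : 0 < ε)
    (hU : ∀ x : E3, x ≠ 0 → closedBall (complexify x) (ε * ‖x‖) ⊆ sqSumPos)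
    (h : HasConicExtension ρ ε n g) (i : Fin 3) :
    HasConicExtension ρ ε (n + 1) (pd i g) := by
  refine ⟨by simp [_root_.pd, (h.hasFDerivAt_zero hρ hε).fderiv], ?_⟩
  obtain ⟨-, G, hG, hgG, hb⟩ := h
  refine ⟨fun z => fderiv ℂ G z (Pi.single i 1),
    (ContinuousLinearMap.apply ℂ ℂ (Pi.single i 1 : Fin 3 → ℂ)).comp_analyticOnNhd hG.fderiv,
    fun x hx => ofReal_pd_eq_fderiv hG hgG i hx, fun x hx δ hδ m hm z hz => ?_⟩
  have hball : closedBall z δ ⊆ closedBall (complexify x) ((m + 1 : ℕ) * δ) := by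
    refine closedBall_subset_closedBall' ?_
    rw [mem_closedBall] at hz
    push_cast
    linarith
  have hle : ((m + 1 : ℕ) + n : ℝ) * δ ≤ ε * ‖x‖ := by
    push_cast at hm ⊢
    linarith
  have hsub : closedBall z δ ⊆ sqSumPos := by
    refine hball.trans ((closedBall_subset_closedBall (le_trans ?_ hle)).trans (hU x hx))
    gcongr
    simp
  rw [pow_succ, ← div_div]
  exact norm_fderiv_single_le hG hδ hsub
    (fun w hw => hb x hx δ hδ (m + 1) hle w (hball hw)) i

lemma iterate_pd (hρ : 0 < ρ) (hε : 0 < ε)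
    (hU : ∀ x : E3, x ≠ 0 → closedBall (complexify x) (ε * ‖x‖) ⊆ sqSumPos)
    (h : HasConicExtension ρ ε n g) (i : Fin 3) (k : ℕ) :
    HasConicExtension ρ ε (n + k) ((_root_.pd i)^[k] g) := by
  induction k with
  | zero => exact h
  | succ k ih =>
    rw [Function.iterate_succ_apply']
    exact ih.pd hρ hε hU i

lemma mpd (hρ : 0 < ρ) (hε : 0 < ε)
    (hU : ∀ x : E3, x ≠ 0 → closedBall (complexify x) (ε * ‖x‖) ⊆ sqSumPos)
    (h : HasConicExtension ρ ε 0 g) (β : Fin 3 → ℕ) :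
    HasConicExtension ρ ε (mdeg β) (mpd β g) := by
  have := ((h.iterate_pd hρ hε hU 2 (β 2)).iterate_pd hρ hε hU 1 (β 1)).iterate_pd hρ hε hU 0 (β 0)
  convert this using 1
  · simp only [mdeg]
    omega
  · rfl

lemma contDiff_natCast (hρ : 0 < ρ) (hε : 0 < ε)
    (hU : ∀ x : E3, x ≠ 0 → closedBall (complexify x) (ε * ‖x‖) ⊆ sqSumPos)
    (h : HasConicExtension ρ ε n g) (k : ℕ) : ContDiff ℝ k g := by
  induction k generalizing n g with
  | zero => exact contDiff_zero.2 (h.differentiable hρ hε).continuous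
  | succ k ih =>
    push_cast
    rw [contDiff_succ_iff_fderiv_apply]
    refine ⟨h.differentiable hρ hε, fun hk => by simp at hk, fun v => ?_⟩
    have hv : (fun x => fderiv ℝ g x v) = fun x => ∑ i, v i * _root_.pd i g x := by
      ext x
      conv_lhs => rw [← (EuclideanSpace.basisFun (Fin 3) ℝ).sum_repr v]
      simp [_root_.pd]
    rw [hv]
    exact ContDiff.sum fun i _ => contDiff_const.mul (ih (h.pd hρ hε hU i))

lemma abs_le_factorial (hρ : 0 < ρ) (hε : 0 < ε) (h : HasConicExtension ρ ε n g) (x : E3) :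
    |g x| ≤ Real.exp 1 * (Real.exp 1 / ε * (2 * ρ) ^ ρ) ^ n * (Nat.factorial n : ℝ) ^ (1 + ρ) := by
  rcases eq_or_ne x 0 with rfl | hx
  · rw [h.1, abs_zero]
    positivity
  have hr : 0 < ‖x‖ := norm_pos_iff.2 hx
  have hn : (0 : ℝ) < Nat.factorial n := by positivity
  have hpow : ((n : ℝ) + 1) ^ n ≤ Real.exp 1 ^ (n + 1) * Nat.factorial n := by
    have h := Real.pow_div_factorial_le_exp ((n : ℝ) + 1) (by positivity) n
    rw [div_le_iff₀ hn] at h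
    rw [← Real.exp_nat_mul]
    push_cast
    rwa [mul_one]
  calc |g x| ≤ Real.exp (-(‖x‖ ^ (-(1 / ρ)) / 2)) * (‖x‖⁻¹) ^ n * ((n + 1) / ε) ^ n :=
        h.abs_le hε hx
    _ = Real.exp (-(‖x‖ ^ (-(1 / ρ)) / 2)) * (‖x‖⁻¹) ^ n * ((n + 1 : ℝ) ^ n / ε ^ n) := by
        rw [div_pow]
    _ ≤ (((2 * ρ) ^ ρ) ^ n * (Nat.factorial n : ℝ) ^ ρ) *
          (Real.exp 1 ^ (n + 1) * Nat.factorial n / ε ^ n) := by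
        refine mul_le_mul (exp_neg_rpow_mul_inv_pow_le hρ hr n) ?_ ?_ ?_
        · gcongr
        all_goals positivity
    _ = _ := by
        rw [Real.rpow_add hn, Real.rpow_one, mul_pow, div_pow]
        ring

end HasConicExtension

open scoped Classical in
/-- **The model function `e^{-|x|^{-1/ρ}}` is Gevrey of order `s = 1 + ρ`**
(Lemma 5.2).  The function equal to `e^{-|x|^{-1/ρ}}` for `x ≠ 0` and to `0` at
`x = 0` is `C^∞` on `ℝ³` and satisfies the Gevrey `G^{1+ρ}(ℝ³)` bounds. -/
theorem exp_neg_rpow_gevrey (ρ : ℝ) (hρ : 0 < ρ) :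
    ContDiff ℝ (⊤ : ℕ∞) (fun x : E3 => if x = 0 then (0 : ℝ) else Real.exp (-(‖x‖ ^ (-(1 / ρ))))) ∧
    ∃ c > (0 : ℝ), ∃ A > (0 : ℝ), ∀ β : Fin 3 → ℕ, ∀ x : E3,
      |mpd β (fun x : E3 => if x = 0 then (0 : ℝ) else Real.exp (-(‖x‖ ^ (-(1 / ρ))))) x|
        ≤ c * A ^ mdeg β * (Nat.factorial (mdeg β) : ℝ) ^ (1 + ρ) := by
  obtain ⟨ε, hε, hball⟩ := exists_norm_expNegCpow_le ρ
  have hU : ∀ x : E3, x ≠ 0 → closedBall (complexify x) (ε * ‖x‖) ⊆ sqSumPos :=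
    fun x hx z hz => (hball x hx z hz).1
  have h : HasConicExtension ρ ε 0
      (fun x : E3 => if x = 0 then (0 : ℝ) else Real.exp (-(‖x‖ ^ (-(1 / ρ))))) := by
    refine ⟨if_pos rfl, expNegCpow ρ, analyticOnNhd_expNegCpow ρ, fun x hx => ?_,
      fun x hx δ hδ m hm z hz => ?_⟩
    · beta_reduce
      rw [if_neg hx, expNegCpow_complexify]
    · rw [pow_zero, div_one]
      refine (hball x hx z (closedBall_subset_closedBall ?_ hz)).2
      simpa using hm
  exact ⟨contDiff_infty.2 fun k => h.contDiff_natCast hρ hε hU k, Real.exp 1, Real.exp_pos 1,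
    Real.exp 1 / ε * (2 * ρ) ^ ρ, by positivity,
    fun β x => (h.mpd hρ hε hU β).abs_le_factorial hρ hε x⟩
end
end
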